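/- For every real number n > 0 and every natural number m, the function Ṽ(j) := ∫_{ℝ} exp(−|φ|^n / n) · cos(j·φ) dφ satisfies iteratedDeriv (2m) Ṽ 0 = 2 · (−1)^m · n^{((2m + 1 − n)/n)} · Γ((2m + 1)/n); that is, the even derivatives at zero of the Fourier transform of exp(−|φ|^n/n) are given explicitly in terms of the Gamma function. -/

import Mathlib

open MeasureTheory Set in
/-- The function `x ↦ f |x|` is integrable once `f` is integrable on `(0, ∞)`. -/
theorem integrable_comp_abs_of_integrableOn_Ioi {f : ℝ → ℝ} (hf : IntegrableOn f (Ioi 0)) :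
    Integrable (fun x => f |x|) := by
  have hpos : IntegrableOn (fun x => f |x|) (Ioi 0) :=
    hf.congr_fun (fun x hx => by simp [abs_of_pos (mem_Ioi.mp hx)]) measurableSet_Ioi
  have hneg : IntegrableOn (fun x => f |x|) (Iic 0) := by
    rw [integrableOn_Iic_iff_integrableOn_Iio]
    have h := (Measure.measurePreserving_neg (volume : Measure ℝ)).integrableOn_comp_preimage
      (MeasurableEquiv.neg ℝ).measurableEmbedding (f := fun x => f |x|) (s := Ioi 0)
    simpa [Function.comp_def] using h.2 hpos
  simpa using hneg.union hpos

open MeasureTheory in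
/-- Differentiation under the integral sign for the cosine transform. -/
theorem iteratedDeriv_integral_mul_cos {f : ℝ → ℝ}
    (hf : ∀ k : ℕ, Integrable (fun x => x ^ k * f x)) (k : ℕ) :
    iteratedDeriv k (fun t : ℝ => ∫ x, f x * Real.cos (t * x)) =
      fun t => ∫ x, x ^ k * f x * Real.cos (t * x + k * (Real.pi / 2)) := by
  induction k with
  | zero => simp
  | succ k ih =>
    rw [iteratedDeriv_succ, ih]
    ext t
    have hmeas (l : ℕ) (s c : ℝ) :
        AEStronglyMeasurable (fun x => x ^ l * f x * Real.cos (s * x + c)) volume :=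
      (hf l).aestronglyMeasurable.mul (by fun_prop : Continuous _).aestronglyMeasurable
    refine (hasDerivAt_integral_of_dominated_loc_of_deriv_le (s := Set.univ)
      (bound := fun x => ‖x ^ (k + 1) * f x‖)
      (F' := fun s x => x ^ (k + 1) * f x * Real.cos (s * x + (k + 1 : ℕ) * (Real.pi / 2)))
      Filter.univ_mem (.of_forall fun s => hmeas _ _ _) ?_ (hmeas _ _ _) ?_ (hf (k + 1)).norm
      ?_).2.deriv
    · refine (hf k).mono (hmeas _ _ _) (.of_forall fun x => ?_)
      rw [norm_mul]
      exact mul_le_of_le_one_right (norm_nonneg _) (Real.abs_cos_le_one _)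
    · refine .of_forall fun x s _ => ?_
      rw [norm_mul]
      exact mul_le_of_le_one_right (norm_nonneg _) (Real.abs_cos_le_one _)
    · refine .of_forall fun x s _ => ?_
      have h := ((((hasDerivAt_id s).mul_const x).add_const (k * (Real.pi / 2))).cos).const_mul
        (x ^ k * f x)
      convert! h using 1
      rw [Nat.cast_succ, add_one_mul, ← add_assoc, Real.cos_add_pi_div_two]
      simp only [id]
      ring

open MeasureTheory Set in
/-- All polynomial moments of `exp (-|x| ^ p / p)` are finite. -/
theorem integrable_pow_mul_exp_neg_abs_rpow_div {p : ℝ} (hp : 0 < p) (k : ℕ) :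
    Integrable (fun x : ℝ => x ^ k * Real.exp (-|x| ^ p / p)) := by
  have h := integrable_comp_abs_of_integrableOn_Ioi
    (integrableOn_rpow_mul_exp_neg_mul_rpow (p := p) (s := k) (b := p⁻¹)
      (by linarith [(Nat.cast_nonneg k : (0 : ℝ) ≤ k)]) hp (inv_pos.2 hp))
  refine h.mono (by fun_prop) (.of_forall fun x => le_of_eq ?_)
  simp [div_eq_inv_mul]

open MeasureTheory Set in
/-- The even moments of `exp (-|x| ^ p / p)`. -/
theorem integral_pow_even_mul_exp_neg_abs_rpow_div {p : ℝ} (hp : 0 < p) (m : ℕ) :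
    ∫ x : ℝ, x ^ (2 * m) * Real.exp (-|x| ^ p / p) =
      2 * p ^ ((2 * (m : ℝ) + 1 - p) / p) * Real.Gamma ((2 * (m : ℝ) + 1) / p) := by
  have h := integral_rpow_mul_exp_neg_mul_rpow (p := p) (q := (2 * m : ℕ)) (b := p⁻¹) hp
    (by linarith [(Nat.cast_nonneg (2 * m) : (0 : ℝ) ≤ (2 * m : ℕ))]) (inv_pos.2 hp)
  have hcomp := integral_comp_abs
    (f := fun x : ℝ => x ^ ((2 * m : ℕ) : ℝ) * Real.exp (-p⁻¹ * x ^ p))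
  rw [h] at hcomp
  have hpow : (p⁻¹ : ℝ) ^ (-(((2 * m : ℕ) : ℝ) + 1) / p) * (1 / p) =
      p ^ ((2 * (m : ℝ) + 1 - p) / p) := by
    rw [Real.inv_rpow hp.le, ← Real.rpow_neg hp.le, sub_div, div_self hp.ne',
      Real.rpow_sub_one hp.ne', mul_one_div]
    push_cast
    ring_nf
  rw [hpow] at hcomp
  push_cast at hcomp
  rw [mul_assoc, ← hcomp]
  refine integral_congr_ae (.of_forall fun x => ?_)
  have hx : |x| ^ (2 * (m : ℝ)) = x ^ (2 * m) := by
    rw [← (even_two_mul m).pow_abs x]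
    exact_mod_cast Real.rpow_natCast |x| (2 * m)
  simp only [hx, neg_mul, mul_neg, div_eq_inv_mul]

/-- The even derivatives at zero of the Fourier transform of `exp(-|φ|^n/n)`:
`Ṽ^(2m)(0) = 2 (-1)^m n^((2m+1-n)/n) Γ((2m+1)/n)`. -/
theorem iteratedDeriv_fourier_exp_neg_abs_rpow (n : ℝ) (hn : 0 < n) (m : ℕ) :
    iteratedDeriv (2 * m)
        (fun j : ℝ => ∫ φ : ℝ, Real.exp (-|φ| ^ n / n) * Real.cos (j * φ)) 0
      = 2 * (-1 : ℝ) ^ m * n ^ ((2 * (m : ℝ) + 1 - n) / n)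
          * Real.Gamma ((2 * (m : ℝ) + 1) / n) := by
  rw [iteratedDeriv_integral_mul_cos (integrable_pow_mul_exp_neg_abs_rpow_div hn)]
  have hcos : Real.cos ((2 * m : ℕ) * (Real.pi / 2)) = (-1) ^ m := by
    rw [← Real.cos_nat_mul_pi]
    push_cast
    ring_nf
  simp only [zero_mul, zero_add, hcos]
  rw [MeasureTheory.integral_mul_const, integral_pow_even_mul_exp_neg_abs_rpow_div hn]
  ring
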